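/- arXiv:1801.07428 — 3 statements merged into one kernel-verified Lean document; each statement's English description precedes it below -/
import Mathlib

section
/- Let n ≥ 1 and d be natural numbers. The set of functions f : ℂⁿ → ℂ that are entire (complex differentiable everywhere) and satisfy a polynomial growth bound |f(z)| ≤ C·(1 + ‖z‖)^d for some constant C > 0 (depending on f) forms a complex vector subspace of the space of all functions ℂⁿ → ℂ, and its dimension over ℂ equals the binomial coefficient C(n + d, n). -/
/-- An entire function of one variable with growth of order at most `d` is a polynomial of degree
at most `d`. -/
theorem Differentiable.exists_polynomial_of_norm_le {g : ℂ → ℂ} (hg : Differentiable ℂ g)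
    {C : ℝ} {d : ℕ} (hC : ∀ t, ‖g t‖ ≤ C * (1 + ‖t‖) ^ d) :
    ∃ p : Polynomial ℂ, p.natDegree ≤ d ∧ ∀ t, g t = p.eval t := by
  have hder : ∀ k, d < k → iteratedDeriv k g 0 = 0 := by
    intro k hk
    have hC0 : 0 ≤ C := by simpa using (norm_nonneg (g 0)).trans (hC 0)
    have hbound : ∀ R : ℝ, 1 ≤ R → ‖iteratedDeriv k g 0‖ ≤ (k.factorial * (C * 2 ^ d)) / R := by
      intro R hR
      have hR0 : 0 < R := by linarith
      have h := Complex.norm_iteratedDeriv_le_of_forall_mem_sphere_norm_le (c := 0)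
        (C := C * (2 * R) ^ d) k hR0 hg.diffContOnCl (fun z hz => by
          rw [mem_sphere_zero_iff_norm] at hz
          refine (hC z).trans ?_
          rw [hz]
          gcongr
          linarith)
      refine h.trans ?_
      rw [div_le_div_iff₀ (by positivity) hR0]
      have : R ^ d * R ≤ R ^ k := by
        rw [← pow_succ]
        exact pow_le_pow_right₀ hR hk
      calc (k.factorial * (C * (2 * R) ^ d)) * R
          = (k.factorial * (C * 2 ^ d)) * (R ^ d * R) := by ring
        _ ≤ _ := by gcongr
    have hlim : Filter.Tendsto (fun R : ℝ => (k.factorial * (C * 2 ^ d)) / R) Filter.atTop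
        (nhds 0) := Filter.tendsto_id.const_div_atTop _
    exact norm_le_zero_iff.1 (ge_of_tendsto hlim
      ((Filter.eventually_ge_atTop 1).mono hbound))
  refine ⟨∑ k ∈ Finset.range (d + 1),
    Polynomial.monomial k ((k.factorial : ℂ)⁻¹ * iteratedDeriv k g 0), ?_, fun t => ?_⟩
  · refine Polynomial.natDegree_sum_le_of_forall_le _ _ fun k hk => ?_
    exact (Polynomial.natDegree_monomial_le _).trans (Nat.lt_succ_iff.1 (Finset.mem_range.1 hk))
  · rw [← Complex.taylorSeries_eq_of_entire' 0 t hg, tsum_eq_sum (s := Finset.range (d + 1)),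
      Polynomial.eval_finsetSum]
    · simp
    · intro k hk
      rw [hder k (by simpa [Nat.lt_succ_iff] using hk)]
      simp

/-- A function which is a polynomial of bounded degree in each variable separately is a
polynomial. -/
theorem MvPolynomial.exists_eval_eq_of_separately_polynomial {K : Type*} [Field K] [Infinite K]
    (d : ℕ) {n : ℕ} {f : (Fin n → K) → K}
    (hf : ∀ x i, ∃ p : Polynomial K, p.natDegree ≤ d ∧
      ∀ t, f (Function.update x i t) = p.eval t) :
    ∃ P : MvPolynomial (Fin n) K, ∀ x, f x = MvPolynomial.eval x P := by
  classical
  induction n with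
  | zero => exact ⟨MvPolynomial.C (f 0), fun x => by simp [Subsingleton.elim x 0]⟩
  | succ n ih =>
    obtain ⟨s, hs⟩ := Infinite.exists_subset_card_eq K (d + 1)
    have key : ∀ c : K, ∃ P : MvPolynomial (Fin n) K,
        ∀ x, f (Fin.cons c x) = MvPolynomial.eval x P := by
      intro c
      refine ih (f := fun x => f (Fin.cons c x)) fun x i => ?_
      obtain ⟨p, hp, h⟩ := hf (Fin.cons c x) i.succ
      exact ⟨p, hp, fun t => by rw [← h, Fin.cons_update]⟩
    choose P hP using key
    refine ⟨∑ c ∈ s, MvPolynomial.rename Fin.succ (P c) *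
      Polynomial.aeval (MvPolynomial.X 0) (Lagrange.basis s id c), fun x => ?_⟩
    obtain ⟨p, hp, h⟩ := hf x 0
    have hdeg : p.degree < s.card := by
      rw [hs]
      exact Polynomial.degree_le_natDegree.trans_lt (by exact_mod_cast Nat.lt_succ_of_le hp)
    have hint := Lagrange.eq_interpolate (v := id) (Set.injOn_id _) hdeg
    have hx : f x = p.eval (x 0) := by rw [← h, Function.update_eq_self]
    rw [hx, hint, Lagrange.interpolate_apply, Polynomial.eval_finsetSum, map_sum]
    refine Finset.sum_congr rfl fun c _ => ?_
    have hc : p.eval c = MvPolynomial.eval (Fin.tail x) (P c) := by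
      rw [← hP, ← h]
      congr 1
      rw [← Fin.cons_self_tail x, Fin.update_cons_zero, Fin.tail_cons]
    have hX : MvPolynomial.eval x
        (Polynomial.aeval (MvPolynomial.X 0) (Lagrange.basis s id c)) =
          (Lagrange.basis s id c).eval (x 0) := by
      rw [← MvPolynomial.coe_aeval_eq_eval, RingHom.coe_coe, ← Polynomial.aeval_algHom_apply]
      simp
    rw [map_mul, hX, MvPolynomial.eval_rename, Polynomial.eval_mul, Polynomial.eval_C, id, hc]
    rfl

/-- A polynomial whose restriction to each line through the origin has degree at most `d` has
total degree at most `d`. -/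
theorem MvPolynomial.totalDegree_le_of_forall_line {K σ : Type*} [Field K] [Infinite K]
    {P : MvPolynomial σ K} {d : ℕ}
    (hP : ∀ x : σ → K, ∃ p : Polynomial K, p.natDegree ≤ d ∧
      ∀ t : K, MvPolynomial.eval (t • x) P = p.eval t) :
    P.totalDegree ≤ d := by
  have hzero : ∀ k, d < k → MvPolynomial.homogeneousComponent k P = 0 := by
    intro k hk
    by_cases hkP : P.totalDegree < k
    · exact MvPolynomial.homogeneousComponent_eq_zero _ _ hkP
    refine MvPolynomial.funext fun x => ?_
    obtain ⟨p, hp, h⟩ := hP x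
    have heq : p = ∑ i ∈ Finset.range (P.totalDegree + 1), Polynomial.monomial i
        (MvPolynomial.eval x (MvPolynomial.homogeneousComponent i P)) := by
      refine Polynomial.funext fun t => ?_
      conv_lhs => rw [← h, ← MvPolynomial.sum_homogeneousComponent P]
      rw [map_sum, Polynomial.eval_finsetSum]
      refine Finset.sum_congr rfl fun i _ => ?_
      have hhom := MvPolynomial.homogeneousComponent_isHomogeneous i P
      rw [MvPolynomial.eval_eq, MvPolynomial.eval_eq, Polynomial.eval_monomial, Finset.sum_mul]
      refine Finset.sum_congr rfl fun m hm => ?_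
      have hdeg : ∑ j ∈ m.support, m j = i := by
        change m.degree = i
        rw [Finsupp.degree_eq_weight_one]
        exact hhom (MvPolynomial.mem_support_iff.1 hm)
      simp only [Pi.smul_apply, smul_eq_mul, mul_pow, Finset.prod_mul_distrib,
        Finset.prod_pow_eq_pow_sum, hdeg]
      ring
    have hcoeff := Polynomial.coeff_eq_zero_of_natDegree_lt (hp.trans_lt hk)
    rw [heq, Polynomial.finsetSum_coeff] at hcoeff
    simpa [Polynomial.coeff_monomial, Nat.lt_succ_iff, not_lt.1 hkP] using hcoeff
  refine Finset.sup_le fun m hm => ?_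
  by_contra! hlt
  have := congrArg (MvPolynomial.coeff m) (hzero m.degree hlt)
  rw [MvPolynomial.coeff_homogeneousComponent, if_pos rfl] at this
  exact MvPolynomial.mem_support_iff.1 hm this

/-- A polynomial of total degree at most `d` has growth of order at most `d`. -/
theorem MvPolynomial.exists_norm_eval_le {n d : ℕ} {P : MvPolynomial (Fin n) ℂ}
    (hP : P.totalDegree ≤ d) :
    ∃ C : ℝ, 0 < C ∧ ∀ z : EuclideanSpace ℂ (Fin n),
      ‖MvPolynomial.eval z P‖ ≤ C * (1 + ‖z‖) ^ d := by
  refine ⟨∑ m ∈ P.support, ‖P.coeff m‖ + 1, by positivity, fun z => ?_⟩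
  rw [MvPolynomial.eval_eq]
  have hterm : ∀ m ∈ P.support,
      ‖P.coeff m * ∏ i ∈ m.support, z i ^ m i‖ ≤ ‖P.coeff m‖ * (1 + ‖z‖) ^ d := by
    intro m hm
    rw [norm_mul, norm_prod]
    gcongr
    calc ∏ i ∈ m.support, ‖z i ^ m i‖ ≤ ∏ i ∈ m.support, (1 + ‖z‖) ^ m i := by
          refine Finset.prod_le_prod (fun _ _ => norm_nonneg _) fun i _ => ?_
          rw [norm_pow]
          gcongr
          linarith [PiLp.norm_apply_le z i]
      _ = (1 + ‖z‖) ^ ∑ i ∈ m.support, m i := Finset.prod_pow_eq_pow_sum _ _ _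
      _ ≤ (1 + ‖z‖) ^ d := pow_le_pow_right₀ (by linarith [norm_nonneg z])
          ((MvPolynomial.le_totalDegree hm).trans hP)
  calc _ ≤ ∑ m ∈ P.support, ‖P.coeff m‖ * (1 + ‖z‖) ^ d := norm_sum_le_of_le _ hterm
    _ = (∑ m ∈ P.support, ‖P.coeff m‖) * (1 + ‖z‖) ^ d := (Finset.sum_mul _ _ _).symm
    _ ≤ _ := by
      gcongr
      linarith

/-- An entire function on `ℂⁿ` with growth of order at most `d` is a polynomial of total degree at
most `d`. -/
theorem Differentiable.exists_mvPolynomial_of_norm_le {n d : ℕ}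
    {f : EuclideanSpace ℂ (Fin n) → ℂ} (hf : Differentiable ℂ f) {C : ℝ}
    (hC : ∀ z, ‖f z‖ ≤ C * (1 + ‖z‖) ^ d) :
    ∃ P : MvPolynomial (Fin n) ℂ, P.totalDegree ≤ d ∧ ∀ z, f z = MvPolynomial.eval z P := by
  have hC0 : 0 ≤ C := by simpa using (norm_nonneg (f 0)).trans (hC 0)
  have hline : ∀ x v : EuclideanSpace ℂ (Fin n), ∃ p : Polynomial ℂ, p.natDegree ≤ d ∧
      ∀ t : ℂ, f (x + t • v) = p.eval t := by
    intro x v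
    refine Differentiable.exists_polynomial_of_norm_le (g := fun t => f (x + t • v))
      (hf.comp (by fun_prop)) (C := C * (1 + ‖x‖ + ‖v‖) ^ d) fun t => ?_
    refine (hC _).trans ?_
    rw [mul_assoc, ← mul_pow]
    have h : ‖x + t • v‖ ≤ ‖x‖ + ‖t‖ * ‖v‖ := (norm_add_le _ _).trans_eq (by rw [norm_smul])
    gcongr
    nlinarith [norm_nonneg x, norm_nonneg v, norm_nonneg t,
      mul_nonneg (norm_nonneg x) (norm_nonneg t)]
  obtain ⟨P, hP⟩ := MvPolynomial.exists_eval_eq_of_separately_polynomial d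
    (f := fun x => f (WithLp.toLp 2 x)) fun x i => by
      obtain ⟨p, hp, h⟩ := hline (WithLp.toLp 2 (Function.update x i 0))
        (WithLp.toLp 2 (Pi.single i 1))
      refine ⟨p, hp, fun t => ?_⟩
      rw [← h]
      congr 1
      ext j
      by_cases hj : j = i
      · subst hj; simp
      · simp [hj]
  refine ⟨P, MvPolynomial.totalDegree_le_of_forall_line fun x => ?_, fun z => hP z⟩
  obtain ⟨p, hp, h⟩ := hline 0 (WithLp.toLp 2 x)
  exact ⟨p, hp, fun t => by rw [← h, ← hP, zero_add, WithLp.toLp_smul]⟩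

theorem MvPolynomial.rank_restrictTotalDegree (K : Type*) [Field K] (n d : ℕ) :
    Module.rank K (MvPolynomial.restrictTotalDegree (Fin n) K d) =
      ((n + d).choose n : Cardinal) := by
  classical
  let B : Finset (Fin n →₀ ℕ) :=
    (Finset.range (d + 1)).biUnion fun k => Finset.finsuppAntidiag Finset.univ k
  have hB : {m : Fin n →₀ ℕ | (m.sum fun _ e => e) ≤ d} = B := by
    ext m
    simp [B, Finsupp.sum_fintype]
  have hcard : B.card = (n + d).choose n := by
    rw [Finset.card_biUnion]
    · simp_rw [Finset.card_finsuppAntidiag_nat_eq_multichoose]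
      rw [Finset.card_univ, Fintype.card_fin, Nat.sum_range_multichoose, add_comm]
    · intro i _ j _ hij
      rw [Function.onFun, Finset.disjoint_left]
      intro m hi hj
      exact hij ((Finset.mem_finsuppAntidiag.1 hi).1.symm.trans (Finset.mem_finsuppAntidiag.1 hj).1)
  rw [MvPolynomial.restrictTotalDegree, hB,
    rank_eq_card_basis (MvPolynomial.basisRestrictSupport K (B : Set (Fin n →₀ ℕ)))]
  simp [hcard]

/-- Evaluation of polynomials on `ℂⁿ`, as a linear map. -/
noncomputable def mvPolynomialToFun (n : ℕ) :
    MvPolynomial (Fin n) ℂ →ₗ[ℂ] (EuclideanSpace ℂ (Fin n) → ℂ) :=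
  LinearMap.pi fun z => (MvPolynomial.aeval (z : Fin n → ℂ)).toLinearMap

theorem mvPolynomialToFun_apply {n : ℕ} (P : MvPolynomial (Fin n) ℂ)
    (z : EuclideanSpace ℂ (Fin n)) : mvPolynomialToFun n P z = MvPolynomial.eval z P :=
  MvPolynomial.aeval_eq_eval z ▸ rfl

theorem mvPolynomialToFun_injective (n : ℕ) : Function.Injective (mvPolynomialToFun n) := by
  intro P Q h
  refine MvPolynomial.funext fun x => ?_
  simpa only [mvPolynomialToFun_apply] using congrFun h (WithLp.toLp 2 x)

theorem differentiable_mvPolynomialToFun {n : ℕ} (P : MvPolynomial (Fin n) ℂ) :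
    Differentiable ℂ (mvPolynomialToFun n P) := by
  have h : mvPolynomialToFun n P =
      fun z => ∑ m ∈ P.support, P.coeff m * ∏ i ∈ m.support, z i ^ m i := by
    ext z
    rw [mvPolynomialToFun_apply, MvPolynomial.eval_eq]
  rw [h]
  fun_prop

theorem polyGrowth_entire_dimension (n d : ℕ) (hn : 1 ≤ n) :
    ∃ S : Submodule ℂ (EuclideanSpace ℂ (Fin n) → ℂ),
      (∀ f : EuclideanSpace ℂ (Fin n) → ℂ,
          f ∈ S ↔ (Differentiable ℂ f ∧
            ∃ C : ℝ, 0 < C ∧ ∀ z, ‖f z‖ ≤ C * (1 + ‖z‖) ^ d)) ∧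
      Module.rank ℂ S = ((n + d).choose n : Cardinal) := by
  refine ⟨(MvPolynomial.restrictTotalDegree (Fin n) ℂ d).map (mvPolynomialToFun n), fun f => ?_, ?_⟩
  · rw [Submodule.mem_map]
    constructor
    · rintro ⟨P, hP, rfl⟩
      refine ⟨differentiable_mvPolynomialToFun P, ?_⟩
      simp_rw [mvPolynomialToFun_apply]
      exact MvPolynomial.exists_norm_eval_le ((MvPolynomial.mem_restrictTotalDegree _ _ _).1 hP)
    · rintro ⟨hf, C, -, hC⟩
      obtain ⟨P, hP, h⟩ := hf.exists_mvPolynomial_of_norm_le hC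
      exact ⟨P, (MvPolynomial.mem_restrictTotalDegree _ _ _).2 hP,
        funext fun z => (mvPolynomialToFun_apply P z).trans (h z).symm⟩
  · rw [← MvPolynomial.rank_restrictTotalDegree ℂ n d]
    exact (Submodule.equivMapOfInjective _ (mvPolynomialToFun_injective n) _).rank_eq.symm
end

section
/- Let n ≥ 1 and d be natural numbers, and let f : ℂⁿ → ℂ be entire (complex differentiable everywhere). If there is a constant C > 0 such that |f(z)| ≤ C·(1 + ‖z‖)^d for all z ∈ ℂⁿ, then f is a polynomial of total degree at most d: there exists a multivariate polynomial p in n complex variables with totalDegree p ≤ d such that f(z) = p(z) for all z. -/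
/-- The Taylor coefficients at the origin of an entire function of polynomial growth of degree at
most `d` vanish beyond order `d`. -/
theorem iteratedDeriv_eq_zero_of_polyGrowth {g : ℂ → ℂ} (hg : Differentiable ℂ g) {C : ℝ} {d k : ℕ}
    (hbound : ∀ t, ‖g t‖ ≤ C * (1 + ‖t‖) ^ d) (hk : d < k) : iteratedDeriv k g 0 = 0 := by
  have hC : 0 ≤ C := by simpa using (norm_nonneg _).trans (hbound 0)
  have cauchy : ∀ R : ℝ, 1 ≤ R → ‖iteratedDeriv k g 0‖ ≤ (k.factorial * C * 2 ^ d) / R := by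
    intro R hR
    have hR0 : 0 < R := by linarith
    have hle : ‖iteratedDeriv k g 0‖ ≤ k.factorial * (C * (2 * R) ^ d) / R ^ k := by
      refine Complex.norm_iteratedDeriv_le_of_forall_mem_sphere_norm_le k hR0 hg.diffContOnCl ?_
      intro z hz
      rw [mem_sphere_zero_iff_norm] at hz
      refine (hbound z).trans ?_
      gcongr
      linarith
    refine hle.trans ?_
    rw [div_le_div_iff₀ (by positivity) hR0]
    have hpow : R ^ d * R ≤ R ^ k := by
      rw [← pow_succ]
      exact pow_le_pow_right₀ hR hk
    calc k.factorial * (C * (2 * R) ^ d) * R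
        = k.factorial * C * 2 ^ d * (R ^ d * R) := by rw [mul_pow]; ring
      _ ≤ k.factorial * C * 2 ^ d * R ^ k := by gcongr
  have hlim : Filter.Tendsto (fun R : ℝ => (k.factorial * C * 2 ^ d) / R) Filter.atTop (nhds 0) :=
    Filter.tendsto_id.const_div_atTop _
  exact norm_le_zero_iff.1 (ge_of_tendsto hlim ((Filter.eventually_ge_atTop 1).mono cauchy))

/-- An entire function of one variable of polynomial growth of degree at most `d` is a polynomial
of degree at most `d`. -/
theorem exists_polynomial_of_polyGrowth {g : ℂ → ℂ} (hg : Differentiable ℂ g) {C : ℝ} {d : ℕ}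
    (hbound : ∀ t, ‖g t‖ ≤ C * (1 + ‖t‖) ^ d) :
    ∃ q : Polynomial ℂ, q.natDegree ≤ d ∧ ∀ t, g t = q.eval t := by
  refine ⟨∑ k ∈ Finset.range (d + 1),
    Polynomial.C ((k.factorial : ℂ)⁻¹ * iteratedDeriv k g 0) * Polynomial.X ^ k, ?_, fun t => ?_⟩
  · refine Polynomial.natDegree_sum_le_of_forall_le _ _ fun k hk => ?_
    exact (Polynomial.natDegree_C_mul_X_pow_le _ _).trans
      (Nat.lt_succ_iff.1 (Finset.mem_range.1 hk))
  · rw [← Complex.taylorSeries_eq_of_entire' 0 t hg, tsum_eq_sum (s := Finset.range (d + 1))]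
    · simp [Polynomial.eval_finsetSum]
    · intro k hk
      rw [iteratedDeriv_eq_zero_of_polyGrowth hg hbound (by simpa using hk)]
      simp

/-- A function on `Kⁿ`, with `K` an infinite field, that is a polynomial of degree at most `d` in
each variable separately is a polynomial. -/
theorem exists_mvPolynomial_of_separately_polynomial {K : Type*} [Field K] [Infinite K] (d : ℕ) :
    ∀ {n : ℕ} (f : (Fin n → K) → K),
      (∀ x i, ∃ q : Polynomial K, q.natDegree ≤ d ∧ ∀ t, f (Function.update x i t) = q.eval t) →
      ∃ p : MvPolynomial (Fin n) K, ∀ x, f x = MvPolynomial.eval x p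
  | 0, f, _ => ⟨MvPolynomial.C (f 0), fun x => by simp [Subsingleton.elim x 0]⟩
  | n + 1, f, hf => by
    let a := Infinite.natEmbedding K
    let s := Finset.range (d + 1)
    have hslice : ∀ j, ∃ p : MvPolynomial (Fin n) K,
        ∀ y, f (Fin.cons (a j) y) = MvPolynomial.eval y p := fun j =>
      exists_mvPolynomial_of_separately_polynomial d (fun y => f (Fin.cons (a j) y))
        fun y i => by simpa only [Fin.cons_update] using hf (Fin.cons (a j) y) i.succ
    choose p hp using hslice
    refine ⟨∑ j ∈ s, MvPolynomial.rename Fin.succ (p j) *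
      Polynomial.aeval (MvPolynomial.X 0) (Lagrange.basis s a j), fun x => ?_⟩
    obtain ⟨w, y, rfl⟩ : ∃ w y, x = Fin.cons w y := ⟨x 0, Fin.tail x, (Fin.cons_self_tail x).symm⟩
    obtain ⟨q, hqd, hq⟩ := hf (Fin.cons w y) 0
    simp only [Fin.update_cons_zero] at hq
    have hinterp : q = Lagrange.interpolate s a fun j => f (Fin.cons (a j) y) := by
      refine Lagrange.eq_interpolate_of_eval_eq _ a.injective.injOn ?_ fun j _ => (hq _).symm
      refine Polynomial.degree_le_natDegree.trans_lt ?_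
      rw [Finset.card_range]
      exact_mod_cast Nat.lt_succ_of_le hqd
    have heval : ∀ b : Polynomial K, MvPolynomial.eval (Fin.cons w y : Fin (n + 1) → K)
        (Polynomial.aeval (MvPolynomial.X 0) b) = b.eval w := fun b => by
      rw [Polynomial.aeval_def, Polynomial.hom_eval₂, MvPolynomial.algebraMap_eq,
        MvPolynomial.eval_X, Fin.cons_zero,
        show (MvPolynomial.eval (Fin.cons w y : Fin (n + 1) → K)).comp MvPolynomial.C =
          RingHom.id K from RingHom.ext fun c => MvPolynomial.eval_C c,
        Polynomial.eval₂_id]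
    have hcomp : (Fin.cons w y : Fin (n + 1) → K) ∘ Fin.succ = y := by
      ext i
      simp
    rw [hq w, hinterp, Lagrange.interpolate_apply, Polynomial.eval_finsetSum, map_sum]
    refine Finset.sum_congr rfl fun j _ => ?_
    rw [map_mul, heval, MvPolynomial.eval_rename, hcomp, ← hp j, Polynomial.eval_mul,
      Polynomial.eval_C]

theorem MvPolynomial.IsHomogeneous.eval_smul {σ R : Type*} [CommSemiring R]
    {p : MvPolynomial σ R} {m : ℕ} (hp : p.IsHomogeneous m) (t : R) (z : σ → R) :
    MvPolynomial.eval (t • z) p = t ^ m * MvPolynomial.eval z p := by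
  simp only [MvPolynomial.eval_eq, Finset.mul_sum]
  refine Finset.sum_congr rfl fun e he => ?_
  have hdeg : ∑ i ∈ e.support, e i = m := by
    rw [← Finsupp.degree_apply, Finsupp.degree_eq_weight_one]
    exact hp (MvPolynomial.mem_support_iff.1 he)
  simp only [Pi.smul_apply, smul_eq_mul, mul_pow, Finset.prod_mul_distrib,
    Finset.prod_pow_eq_pow_sum, hdeg]
  ring

/-- The total degree of a polynomial over an infinite field is bounded by the degrees of its
restrictions to lines through the origin. -/
theorem MvPolynomial.totalDegree_le_of_radial {K σ : Type*} [Field K] [Infinite K] {d : ℕ}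
    (p : MvPolynomial σ K)
    (hp : ∀ z : σ → K, ∃ q : Polynomial K, q.natDegree ≤ d ∧
      ∀ t : K, MvPolynomial.eval (t • z) p = q.eval t) : p.totalDegree ≤ d := by
  have hzero : ∀ m, d < m → MvPolynomial.homogeneousComponent m p = 0 := by
    intro m hm
    refine MvPolynomial.funext fun z => ?_
    obtain ⟨q, hqd, hq⟩ := hp z
    have hradial : q = ∑ k ∈ Finset.range (p.totalDegree + 1), Polynomial.C
        (MvPolynomial.eval z (MvPolynomial.homogeneousComponent k p)) * Polynomial.X ^ k := by
      refine Polynomial.funext fun t => ?_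
      rw [← hq t]
      conv_lhs => rw [← MvPolynomial.sum_homogeneousComponent p]
      rw [map_sum, Polynomial.eval_finsetSum]
      refine Finset.sum_congr rfl fun k _ => ?_
      rw [(MvPolynomial.homogeneousComponent_isHomogeneous k p).eval_smul, mul_comm]
      simp
    have hcoeff : q.coeff m = 0 := Polynomial.coeff_eq_zero_of_natDegree_lt (hqd.trans_lt hm)
    rw [map_zero]
    by_cases hmp : p.totalDegree < m
    · rw [MvPolynomial.homogeneousComponent_eq_zero m p hmp, map_zero]
    · rw [hradial] at hcoeff
      simpa [Polynomial.finsetSum_coeff, Polynomial.coeff_C_mul, Polynomial.coeff_X_pow,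
        Nat.lt_succ_iff, not_lt.1 hmp] using hcoeff
  rw [← MvPolynomial.sum_homogeneousComponent p]
  refine MvPolynomial.totalDegree_finsetSum_le fun m _ => ?_
  by_cases hm : d < m
  · simp [hzero m hm]
  · exact (MvPolynomial.homogeneousComponent_isHomogeneous m p).totalDegree_le.trans (not_lt.1 hm)

/-- The restriction to a complex line of an entire function of polynomial growth of degree at most
`d` is a polynomial of degree at most `d`. -/
theorem exists_polynomial_on_line_of_polyGrowth {E : Type*} [NormedAddCommGroup E]
    [NormedSpace ℂ E] {f : E → ℂ} (hf : Differentiable ℂ f) {C : ℝ} {d : ℕ}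
    (hbound : ∀ z, ‖f z‖ ≤ C * (1 + ‖z‖) ^ d) (x v : E) :
    ∃ q : Polynomial ℂ, q.natDegree ≤ d ∧ ∀ t : ℂ, f (x + t • v) = q.eval t := by
  have hC : 0 ≤ C :=
    nonneg_of_mul_nonneg_left ((norm_nonneg _).trans (hbound 0)) (by positivity)
  refine exists_polynomial_of_polyGrowth (g := fun t : ℂ => f (x + t • v))
    (C := C * (1 + ‖x‖ + ‖v‖) ^ d) (by fun_prop) fun t => (hbound _).trans ?_
  rw [mul_assoc, ← mul_pow]
  gcongr
  have h := norm_add_le x (t • v)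
  rw [norm_smul] at h
  nlinarith [norm_nonneg x, norm_nonneg v, norm_nonneg t,
    mul_nonneg (norm_nonneg x) (norm_nonneg t)]

theorem entire_polyGrowth_is_polynomial (n d : ℕ) (hn : 1 ≤ n)
    (f : EuclideanSpace ℂ (Fin n) → ℂ) (hf : Differentiable ℂ f)
    (C : ℝ) (hC : 0 < C) (hbound : ∀ z, ‖f z‖ ≤ C * (1 + ‖z‖) ^ d) :
    ∃ p : MvPolynomial (Fin n) ℂ, p.totalDegree ≤ d ∧
      ∀ z : EuclideanSpace ℂ (Fin n), f z = MvPolynomial.eval (fun i => z i) p := by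
  have hline := exists_polynomial_on_line_of_polyGrowth hf hbound
  obtain ⟨p, hp⟩ := exists_mvPolynomial_of_separately_polynomial d
    (fun x : Fin n → ℂ => f (WithLp.toLp 2 x)) fun x i => by
      obtain ⟨q, hqd, hq⟩ := hline (WithLp.toLp 2 (Function.update x i 0))
        (EuclideanSpace.single i 1)
      refine ⟨q, hqd, fun t => ?_⟩
      rw [← hq t]
      congr 1
      ext j
      by_cases hj : j = i
      · subst hj
        simp
      · simp [hj]
  refine ⟨p, p.totalDegree_le_of_radial fun z => ?_, fun z => hp z⟩
  obtain ⟨q, hqd, hq⟩ := hline 0 (WithLp.toLp 2 z)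
  refine ⟨q, hqd, fun t => ?_⟩
  rw [← hp, ← hq t, zero_add, WithLp.toLp_smul]
end

section
/- Let θ ∈ (0, 1), K ≥ 1, w > 0, and M ≥ 1 be real numbers. Suppose a : ℕ → ℝ is a sequence of nonnegative reals with a_i ≤ M for all i, satisfying a_i ≤ K^{i} · w · a_{i+1}^{θ} for every i ≥ 0. Then a_0 ≤ K^{θ/(1−θ)²} · w^{1/(1−θ)}. -/
open Filter Topology in
/-- A sequence bounded by a constant and satisfying `b i ≤ b (i + 1) ^ θ` with `θ < 1` is at
most `1`. -/
theorem le_one_of_le_succ_rpow {θ C : ℝ} (hθ0 : 0 < θ) (hθ1 : θ < 1) (hC : 0 < C) {b : ℕ → ℝ}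
    (hb : ∀ i, 0 ≤ b i) (hbC : ∀ i, b i ≤ C) (hrec : ∀ i, b i ≤ b (i + 1) ^ θ) (i : ℕ) :
    b i ≤ 1 := by
  have key : ∀ n i : ℕ, b i ≤ C ^ (θ ^ n) := by
    intro n
    induction n with
    | zero => simpa using hbC
    | succ n ih =>
      intro i
      calc b i ≤ b (i + 1) ^ θ := hrec i
        _ ≤ (C ^ (θ ^ n)) ^ θ := Real.rpow_le_rpow (hb _) (ih _) hθ0.le
        _ = C ^ (θ ^ (n + 1)) := by rw [← Real.rpow_mul hC.le, pow_succ]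
  have hlim : Tendsto (fun n : ℕ => C ^ (θ ^ n)) atTop (𝓝 1) := by
    simpa using (tendsto_const_nhds (x := C)).rpow
      (tendsto_pow_atTop_nhds_zero_of_lt_one hθ0.le hθ1) (.inl hC.ne')
  exact ge_of_tendsto' hlim fun n => key n i

theorem reverse_iteration_arith (θ K w M : ℝ) (hθ0 : 0 < θ) (hθ1 : θ < 1)
    (hK : 1 ≤ K) (hw : 0 < w) (hM : 1 ≤ M) (a : ℕ → ℝ) (ha : ∀ i, 0 ≤ a i)
    (haM : ∀ i, a i ≤ M)
    (hrec : ∀ i : ℕ, a i ≤ K ^ (i : ℝ) * w * (a (i + 1)) ^ θ) :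
    a 0 ≤ K ^ (θ / (1 - θ) ^ 2) * w ^ (1 / (1 - θ)) := by
  have hK0 : 0 < K := by linarith
  have hθ : 0 < 1 - θ := by linarith
  -- `B` solves the recursion with equality.
  let B : ℕ → ℝ := fun i => K ^ (θ / (1 - θ) ^ 2 + i / (1 - θ)) * w ^ (1 / (1 - θ))
  have hB : ∀ i, 0 < B i := fun i => by positivity
  have hB0 : ∀ i, B 0 ≤ B i := fun i => by
    refine mul_le_mul_of_nonneg_right (Real.rpow_le_rpow_of_exponent_le hK ?_) (by positivity)
    have : (0 : ℝ) ≤ i / (1 - θ) := by positivity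
    simpa using this
  have hBrec : ∀ i : ℕ, B i = K ^ (i : ℝ) * w * B (i + 1) ^ θ := fun i => by
    simp only [B]
    rw [Real.mul_rpow (by positivity) (by positivity), ← Real.rpow_mul hK0.le,
      ← Real.rpow_mul hw.le, mul_mul_mul_comm, ← Real.rpow_add hK0]
    nth_rewrite 2 [← Real.rpow_one w]
    rw [← Real.rpow_add hw]
    congr 2
    · push_cast
      field_simp
      ring
    · field_simp
      ring
  have h := le_one_of_le_succ_rpow (b := fun i => a i / B i) (C := M / B 0) hθ0 hθ1
    (div_pos (by linarith) (hB 0)) (fun i => div_nonneg (ha i) (hB i).le)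
    (fun i => div_le_div₀ (by linarith) (haM i) (hB 0) (hB0 i))
    (fun i => by
      have hpow : 0 < B (i + 1) ^ θ := Real.rpow_pos_of_pos (hB _) _
      rw [Real.div_rpow (ha _) (hB _).le, div_le_div_iff₀ (hB i) hpow, hBrec i]
      calc a i * B (i + 1) ^ θ
          ≤ K ^ (i : ℝ) * w * a (i + 1) ^ θ * B (i + 1) ^ θ :=
            mul_le_mul_of_nonneg_right (hrec i) hpow.le
        _ = a (i + 1) ^ θ * (K ^ (i : ℝ) * w * B (i + 1) ^ θ) := by ring) 0
  simpa [B] using (div_le_one (hB 0)).mp h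
end
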